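/- arXiv:2112.06236 — 2 statements merged into one kernel-verified Lean document; each statement's English description precedes it below -/
import Mathlib

section
/- Let G be a finite group, let H ≤ A ≤ G be subgroups, and let X be a left transversal of A in G. If XH = HX⁻¹, then the set A/H = {aH : a ∈ A} is a perfect code in the coset graph Cos(G,H,U) where U = H(X \ A)H = {h₁xh₂ : h₁,h₂ ∈ H, x ∈ X, x ∉ A}. -/
open scoped Pointwise

/-- A perfect code in a graph: an independent set `C` of vertices such that every
vertex outside of `C` is adjacent to exactly one vertex in `C`. -/
def IsPerfectCode {V : Type*} (Γ : SimpleGraph V) (C : Set V) : Prop :=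
  (∀ a ∈ C, ∀ b ∈ C, ¬ Γ.Adj a b) ∧ ∀ v ∉ C, ∃! c, c ∈ C ∧ Γ.Adj v c

/-- A total perfect code in a graph: a set `C` of vertices such that every vertex
of the graph is adjacent to exactly one vertex in `C`. -/
def IsTotalPerfectCode {V : Type*} (Γ : SimpleGraph V) (C : Set V) : Prop :=
  ∀ v, ∃! c, c ∈ C ∧ Γ.Adj v c

/-- The coset graph `Cos(G,H,U)`: vertices are the left cosets of `H` in `G`, and
`g₁H` is adjacent to `g₂H` iff `g₁⁻¹ * g₂ ∈ U`.  (When `HUH = U`, `H ∩ U = ∅` and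
`U⁻¹ = U`, this matches the usual definition.) -/
def cosetGraph {G : Type*} [Group G] (H : Subgroup G) (U : Set G) :
    SimpleGraph (G ⧸ H) :=
  SimpleGraph.fromRel fun x y =>
    ∃ g₁ g₂ : G, QuotientGroup.mk g₁ = x ∧ QuotientGroup.mk g₂ = y ∧ g₁⁻¹ * g₂ ∈ U

/-- `A` is a perfect code of the pair `(G,H)`: there is `U ⊆ G` with `HUH = U`,
`H ∩ U = ∅`, `U⁻¹ = U` such that `A/H = {aH : a ∈ A}` is a perfect code in the
coset graph `Cos(G,H,U)`. -/
def IsPerfectCodePair {G : Type*} [Group G] (H A : Subgroup G) : Prop :=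
  ∃ U : Set G,
    (H : Set G) * U * (H : Set G) = U ∧
    (H : Set G) ∩ U = ∅ ∧
    U⁻¹ = U ∧
    IsPerfectCode (cosetGraph H U) ((QuotientGroup.mk : G → G ⧸ H) '' (A : Set G))

/-- `A` is a total perfect code of the pair `(G,H)`. -/
def IsTotalPerfectCodePair {G : Type*} [Group G] (H A : Subgroup G) : Prop :=
  ∃ U : Set G,
    (H : Set G) * U * (H : Set G) = U ∧
    (H : Set G) ∩ U = ∅ ∧
    U⁻¹ = U ∧
    IsTotalPerfectCode (cosetGraph H U) ((QuotientGroup.mk : G → G ⧸ H) '' (A : Set G))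

/-- A left transversal of `A` in `G`: a set containing exactly one element of each
left coset of `A`. -/
def IsLeftTransversal {G : Type*} [Group G] (X : Set G) (A : Subgroup G) : Prop :=
  ∀ g : G, ∃! x, x ∈ X ∧ g⁻¹ * x ∈ A

/-- A right transversal of `A` in `G`: a set containing exactly one element of each
right coset of `A`. -/
def IsRightTransversal {G : Type*} [Group G] (Y : Set G) (A : Subgroup G) : Prop :=
  ∀ g : G, ∃! y, y ∈ Y ∧ y * g⁻¹ ∈ A

theorem cosetGraph_adj_mk {G : Type*} [Group G] {H : Subgroup G} {U : Set G}
    (hU : (H : Set G) * U * (H : Set G) = U) (hHU : (H : Set G) ∩ U = ∅) (hinv : U⁻¹ = U)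
    (g a : G) :
    (cosetGraph H U).Adj (QuotientGroup.mk g) (QuotientGroup.mk a) ↔ g⁻¹ * a ∈ U := by
  have key : ∀ g a : G, (∃ g₁ g₂ : G, (QuotientGroup.mk g₁ : G ⧸ H) = QuotientGroup.mk g ∧
      (QuotientGroup.mk g₂ : G ⧸ H) = QuotientGroup.mk a ∧ g₁⁻¹ * g₂ ∈ U) ↔ g⁻¹ * a ∈ U := by
    intro g a
    refine ⟨?_, fun h => ⟨g, a, rfl, rfl, h⟩⟩
    rintro ⟨g₁, g₂, h₁, h₂, h⟩
    rw [eq_comm, QuotientGroup.eq] at h₁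
    rw [QuotientGroup.eq] at h₂
    rw [← hU, show g⁻¹ * a = (g⁻¹ * g₁) * (g₁⁻¹ * g₂) * (g₂⁻¹ * a) by group]
    exact Set.mul_mem_mul (Set.mul_mem_mul h₁ h) h₂
  have hsymm : a⁻¹ * g ∈ U ↔ g⁻¹ * a ∈ U := by
    nth_rewrite 1 [← hinv]
    rw [Set.mem_inv, mul_inv_rev, inv_inv]
  rw [cosetGraph, SimpleGraph.fromRel_adj, key, key, hsymm, or_self, and_iff_right_iff_imp]
  intro h heq
  rw [QuotientGroup.eq] at heq
  exact (Set.eq_empty_iff_forall_notMem.mp hHU) _ ⟨heq, h⟩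

theorem mul_diff_mul_eq {G : Type*} [Group G] {H A : Subgroup G} (hHA : H ≤ A) {X : Set G}
    (hXH : X * (H : Set G) = (H : Set G) * X⁻¹) :
    (H : Set G) * (X \ (A : Set G)) * (H : Set G) = (X * (H : Set G)) \ (A : Set G) := by
  ext u
  constructor
  · rintro ⟨_, ⟨h, hh, x, ⟨hx, hxA⟩, rfl⟩, k, hk, rfl⟩
    refine ⟨?_, fun hA => hxA ?_⟩
    · have hxk : x * k ∈ (H : Set G) * X⁻¹ := hXH ▸ Set.mul_mem_mul hx hk
      change h * x * k ∈ _
      rw [hXH, mul_assoc, ← coe_mul_coe H, mul_assoc (H : Set G)]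
      exact Set.mul_mem_mul hh hxk
    · have hA : h * x * k ∈ A := hA
      rwa [A.mul_mem_cancel_right (hHA hk), A.mul_mem_cancel_left (hHA hh)] at hA
  · rintro ⟨⟨x, hx, k, hk, rfl⟩, hA⟩
    refine Set.mul_mem_mul ⟨1, H.one_mem, x, ⟨hx, fun hxA => hA ?_⟩, one_mul x⟩ hk
    exact A.mul_mem hxA (hHA hk)

/-- if `X` is a left transversal of `A` in `G` with `XH = HX⁻¹`, then
`U = H(X \ A)H` satisfies `HUH = U`, `H ∩ U = ∅`, `U⁻¹ = U`, and `A/H` is a perfect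
code in the coset graph `Cos(G,H,U)`. -/
theorem perfectCode_cosetGraph_of_leftTransversal
    {G : Type*} [Group G] [Finite G] (H A : Subgroup G) (hHA : H ≤ A)
    (X : Set G) (hX : IsLeftTransversal X A)
    (hXH : X * (H : Set G) = (H : Set G) * X⁻¹) :
    (H : Set G) * ((H : Set G) * (X \ (A : Set G)) * (H : Set G)) * (H : Set G) =
        (H : Set G) * (X \ (A : Set G)) * (H : Set G) ∧
    (H : Set G) ∩ ((H : Set G) * (X \ (A : Set G)) * (H : Set G)) = ∅ ∧
    ((H : Set G) * (X \ (A : Set G)) * (H : Set G))⁻¹ =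
        (H : Set G) * (X \ (A : Set G)) * (H : Set G) ∧
    IsPerfectCode (cosetGraph H ((H : Set G) * (X \ (A : Set G)) * (H : Set G)))
      ((QuotientGroup.mk : G → G ⧸ H) '' (A : Set G)) := by
  have hU := mul_diff_mul_eq hHA hXH
  have h₁ : (H : Set G) * ((H : Set G) * (X \ (A : Set G)) * (H : Set G)) * (H : Set G) =
      (H : Set G) * (X \ (A : Set G)) * (H : Set G) := by
    simp only [← mul_assoc, coe_mul_coe]
    rw [mul_assoc, coe_mul_coe]
  have h₂ : (H : Set G) ∩ ((H : Set G) * (X \ (A : Set G)) * (H : Set G)) = ∅ := by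
    rw [hU]
    exact Set.eq_empty_of_forall_notMem fun u hu => hu.2.2 (hHA hu.1)
  have h₃ : ((H : Set G) * (X \ (A : Set G)) * (H : Set G))⁻¹ =
      (H : Set G) * (X \ (A : Set G)) * (H : Set G) := by
    have hinv : (X * (H : Set G))⁻¹ = X * (H : Set G) := by
      rw [mul_inv_rev, inv_coe_set, hXH]
    rw [hU]
    ext u
    have hmem : u⁻¹ ∈ X * (H : Set G) ↔ u ∈ X * (H : Set G) := by
      rw [← Set.mem_inv, hinv]
    simp only [Set.mem_inv, Set.mem_sdiff, hmem, SetLike.mem_coe, inv_mem_iff]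
  refine ⟨h₁, h₂, h₃, ?_, ?_⟩
  · rintro _ ⟨a, ha, rfl⟩ _ ⟨b, hb, rfl⟩
    rw [cosetGraph_adj_mk h₁ h₂ h₃, hU]
    exact fun h => h.2 (A.mul_mem (A.inv_mem ha) hb)
  · intro v hv
    obtain ⟨g, rfl⟩ := QuotientGroup.mk_surjective v
    have hg : g ∉ A := fun hg => hv ⟨g, hg, rfl⟩
    obtain ⟨x, ⟨hx, hxA⟩, huniq⟩ := hX g⁻¹
    rw [inv_inv] at hxA
    refine ⟨QuotientGroup.mk (g * x), ⟨⟨g * x, hxA, rfl⟩, ?_⟩, ?_⟩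
    · rw [cosetGraph_adj_mk h₁ h₂ h₃, hU, inv_mul_cancel_left]
      refine ⟨⟨x, hx, 1, H.one_mem, mul_one x⟩, fun hx' => hg ?_⟩
      rwa [A.mul_mem_cancel_right hx'] at hxA
    · rintro _ ⟨⟨a, ha, rfl⟩, hadj⟩
      rw [cosetGraph_adj_mk h₁ h₂ h₃, hU] at hadj
      obtain ⟨⟨y, hy, k, hk, hyk⟩, -⟩ := hadj
      have hyk : y * k = g⁻¹ * a := hyk
      obtain rfl : a = g * y * k := by rw [mul_assoc, hyk, mul_inv_cancel_left]
      have hgy : g * y ∈ A := (A.mul_mem_cancel_right (hHA hk)).mp ha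
      rw [← huniq y ⟨hy, by rwa [inv_inv]⟩]
      exact QuotientGroup.mk_mul_of_mem _ hk
end

section
/- Let G be a finite group and let H ≤ A ≤ G be subgroups. Then A is a total perfect code of the pair (G,H) if and only if there exists a left transversal X of A in G such that XH = HX⁻¹ and X contains an element of A \ H (an element of A not in H). -/
open scoped Pointwise

theorem cosetGraph_adj_mk_iff {G : Type*} [Group G] {H : Subgroup G} {U : Set G}
    (hHU : (H : Set G) * U * (H : Set G) = U) (hdisj : (H : Set G) ∩ U = ∅) (hinv : U⁻¹ = U)
    (a b : G) : (cosetGraph H U).Adj (a : G ⧸ H) (b : G ⧸ H) ↔ a⁻¹ * b ∈ U := by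
  have hrel : ∀ a b : G, (∃ g₁ g₂ : G, (g₁ : G ⧸ H) = a ∧ (g₂ : G ⧸ H) = b ∧ g₁⁻¹ * g₂ ∈ U) ↔
      a⁻¹ * b ∈ U := by
    intro a b
    refine ⟨?_, fun h => ⟨a, b, rfl, rfl, h⟩⟩
    rintro ⟨g₁, g₂, h₁, h₂, hU⟩
    have h := Set.mul_mem_mul (Set.mul_mem_mul (QuotientGroup.eq.1 h₁.symm) hU)
      (QuotientGroup.eq.1 h₂)
    rw [hHU] at h
    convert h using 1
    group
  rw [cosetGraph, SimpleGraph.fromRel_adj, hrel, hrel]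
  have hsymm : b⁻¹ * a ∈ U ↔ a⁻¹ * b ∈ U := by
    rw [← Set.inv_mem_inv, hinv]
    simp
  rw [hsymm, or_self, and_iff_right_iff_imp]
  intro h hab
  exact (Set.eq_empty_iff_forall_notMem.1 hdisj) _ ⟨QuotientGroup.eq.1 hab, h⟩

theorem isTotalPerfectCode_cosetGraph_iff {G : Type*} [Group G] {H A : Subgroup G} {U : Set G}
    (hHU : (H : Set G) * U * (H : Set G) = U) (hdisj : (H : Set G) ∩ U = ∅) (hinv : U⁻¹ = U) :
    IsTotalPerfectCode (cosetGraph H U) ((QuotientGroup.mk : G → G ⧸ H) '' (A : Set G)) ↔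
      ∀ g : G, (∃ a ∈ A, g⁻¹ * a ∈ U) ∧
        ∀ a ∈ A, ∀ b ∈ A, g⁻¹ * a ∈ U → g⁻¹ * b ∈ U → a⁻¹ * b ∈ H := by
  have hadj := cosetGraph_adj_mk_iff hHU hdisj hinv
  rw [IsTotalPerfectCode, QuotientGroup.mk_surjective.forall]
  refine forall_congr' fun g => ⟨?_, ?_⟩
  · rintro ⟨_, ⟨⟨a, ha, rfl⟩, hga⟩, huniq⟩
    refine ⟨⟨a, ha, (hadj g a).1 hga⟩, fun b hb c hc hgb hgc => QuotientGroup.eq.1 ?_⟩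
    exact (huniq _ ⟨⟨b, hb, rfl⟩, (hadj g b).2 hgb⟩).trans
      (huniq _ ⟨⟨c, hc, rfl⟩, (hadj g c).2 hgc⟩).symm
  · rintro ⟨⟨a, ha, hga⟩, huniq⟩
    refine ⟨a, ⟨⟨a, ha, rfl⟩, (hadj g a).2 hga⟩, ?_⟩
    rintro _ ⟨⟨b, hb, rfl⟩, hgb⟩
    exact QuotientGroup.eq.2 (huniq b hb a ha ((hadj g b).1 hgb) hga)

/-- `A` is a total perfect code of `(G,H)` iff there is a left
transversal `X` of `A` in `G` with `XH = HX⁻¹` containing an element of `A \ H`. -/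
theorem totalPerfectCodePair_iff_exists_leftTransversal
    {G : Type*} [Group G] [Finite G] (H A : Subgroup G) (hHA : H ≤ A) :
    IsTotalPerfectCodePair H A ↔
      ∃ X : Set G, IsLeftTransversal X A ∧ X * (H : Set G) = (H : Set G) * X⁻¹ ∧
        ∃ x ∈ X, x ∈ A ∧ x ∉ H := by
  constructor
  · rintro ⟨U, hHU, hdisj, hinv, hcode⟩
    rw [isTotalPerfectCode_cosetGraph_iff hHU hdisj hinv] at hcode
    have hUH : ∀ u ∈ U, ∀ h ∈ H, u * h ∈ U := fun u hu h hh => by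
      have := Set.mul_mem_mul (Set.mul_mem_mul H.one_mem hu) hh
      rwa [hHU, one_mul] at this
    have hout : ∀ g : G, g⁻¹ * (g : G ⧸ H).out ∈ H := fun g =>
      QuotientGroup.eq.1 (QuotientGroup.out_eq' (g : G ⧸ H)).symm
    have hU_out : ∀ u ∈ U, (u : G ⧸ H).out ∈ U := fun u hu => by
      simpa using hUH u hu _ (hout u)
    let X : Set G := {x | x ∈ U ∧ (x : G ⧸ H).out = x}
    have hX_out : ∀ u ∈ U, (u : G ⧸ H).out ∈ X := fun u hu =>
      ⟨hU_out u hu, by rw [QuotientGroup.out_eq']⟩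
    have hXH : X * (H : Set G) = U := by
      ext u
      constructor
      · rintro ⟨x, hx, h, hh, rfl⟩
        exact hUH x hx.1 h hh
      · intro hu
        exact ⟨_, hX_out u hu, _, by simpa using H.inv_mem (hout u), mul_inv_cancel_left _ u⟩
    have htrans : IsLeftTransversal X A := by
      intro g
      obtain ⟨⟨a, ha, hga⟩, huniq⟩ := hcode g⁻¹
      rw [inv_inv] at hga huniq
      refine ⟨_, ⟨hX_out _ hga, ?_⟩, ?_⟩
      · simpa [mul_assoc] using A.mul_mem ha (hHA (hout (g * a)))
      · rintro y ⟨⟨hyU, hy⟩, hyA⟩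
        have h := huniq _ hyA a ha (by simpa using hyU) hga
        have hya : (y : G ⧸ H) = (g * a : G) := QuotientGroup.eq.2 (by simpa [mul_assoc] using h)
        rw [← hya, hy]
    refine ⟨X, htrans, ?_, ?_⟩
    · rw [hXH]
      conv_lhs => rw [← hinv, ← hXH, mul_inv_rev, inv_coe_set]
    · obtain ⟨x, ⟨hx, hxA⟩, -⟩ := htrans 1
      refine ⟨x, hx, by simpa using hxA, fun hxH => ?_⟩
      exact (Set.eq_empty_iff_forall_notMem.1 hdisj) x ⟨hxH, hx.1⟩
  · rintro ⟨X, htrans, hXH, x, hxX, hxA, hxH⟩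
    have huniq : ∀ g y z : G, y ∈ X → z ∈ X → g⁻¹ * y ∈ A → g⁻¹ * z ∈ A → y = z :=
      fun g y z hy hz hgy hgz => (htrans g).unique ⟨hy, hgy⟩ ⟨hz, hgz⟩
    have hinv : (X * (H : Set G))⁻¹ = X * (H : Set G) := by
      rw [mul_inv_rev, inv_coe_set, hXH]
    have hHU : (H : Set G) * (X * (H : Set G)) * (H : Set G) = X * (H : Set G) := by
      rw [mul_assoc, mul_assoc, coe_mul_coe, hXH, ← mul_assoc, coe_mul_coe]
    have hdisj : (H : Set G) ∩ (X * (H : Set G)) = ∅ := by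
      rw [Set.eq_empty_iff_forall_notMem]
      rintro _ ⟨hyH, y, hy, h, hh, rfl⟩
      have hyH' : y ∈ H := (H.mul_mem_cancel_right hh).1 hyH
      have hyx : y = x := huniq 1 y x hy hxX (by simpa using hHA hyH') (by simpa using hxA)
      exact hxH (hyx ▸ hyH')
    refine ⟨X * (H : Set G), hHU, hdisj, hinv, ?_⟩
    rw [isTotalPerfectCode_cosetGraph_iff hHU hdisj hinv]
    refine fun g => ⟨?_, ?_⟩
    · obtain ⟨y, ⟨hy, hyA⟩, -⟩ := htrans g⁻¹
      exact ⟨g * y, by simpa using hyA, y, hy, 1, H.one_mem, by simp⟩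
    · rintro a ha b hb ⟨y, hy, h, hh, hyh⟩ ⟨z, hz, k, hk, hzk⟩
      have hgy : a = g * (y * h) := by simp [hyh]
      have hgz : b = g * (z * k) := by simp [hzk]
      subst hgy hgz
      rw [← mul_assoc] at ha hb
      have hyz : y = z := huniq g⁻¹ y z hy hz
        (by simpa using (A.mul_mem_cancel_right (hHA hh)).1 ha)
        (by simpa using (A.mul_mem_cancel_right (hHA hk)).1 hb)
      subst hyz
      simpa [mul_assoc] using H.mul_mem (H.inv_mem hh) hk
end
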